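/- Let (X, ℝ, α) be a one-parameter C*-dynamical system such that sp(α) contains more than three points and X^α([0,∞)) is a maximal norm-closed subalgebra of X, and let Y be a norm-closed α-invariant α-simple two-sided ideal of X with Y^α((0,∞)) = X^α((0,∞)) and Y + X^α([0,∞)) norm-dense in X. Then neither Z₁, the closed linear span of X^α((−∞,0)) X X^α((0,∞)), nor Z₂, the closed linear span of X^α((0,∞)) X X^α((−∞,0)), is contained in Y^α = Y ∩ X^α. -/

import Mathlib

open MeasureTheory Set Filter Topology Pointwise

noncomputable section

namespace PeligradMax

variable {X : Type*} [NonUnitalNormedRing X] [StarRing X] [CStarRing X]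
  [NormedSpace ℂ X] [IsScalarTower ℂ X X] [SMulCommClass ℂ X X] [StarModule ℂ X]
  [CompleteSpace X] [PartialOrder X] [StarOrderedRing X]

/-- A one-parameter C*-dynamical system: a group of *-automorphisms of `X`
with norm-continuous orbit maps. -/
structure IsCStarDynSys (α : ℝ → X → X) : Prop where
  map_zero_time : ∀ x, α 0 x = x
  map_add_time : ∀ s t x, α (s + t) x = α s (α t x)
  map_add : ∀ t x y, α t (x + y) = α t x + α t y
  map_smulc : ∀ (t : ℝ) (c : ℂ) (x : X), α t (c • x) = c • α t x
  map_mul : ∀ t x y, α t (x * y) = α t x * α t y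
  map_star : ∀ t x, α t (star x) = star (α t x)
  continuous_orbit : ∀ x, Continuous fun t => α t x

/-- Closed linear span. -/
def ClosedSpan (S : Set X) : Set X := closure ((Submodule.span ℂ S : Submodule ℂ X) : Set X)

def MulSet2 (S T : Set X) : Set X := {z | ∃ s ∈ S, ∃ t ∈ T, z = s * t}

def MulSet3 (S T R : Set X) : Set X := {z | ∃ s ∈ S, ∃ t ∈ T, ∃ r ∈ R, z = s * t * r}

/-- Fourier transform of an integrable function. -/
def fourierT (f : ℝ → ℂ) (γ : ℝ) : ℂ := ∫ t : ℝ, f t * Complex.exp (-(Complex.I * γ * t))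

/-- `α_f(x) = ∫ f(t) α_t(x) dt`. -/
def smear (α : ℝ → X → X) (f : ℝ → ℂ) (x : X) : X := ∫ t : ℝ, f t • α t x

/-- Arveson spectrum of an element. -/
def elemSpec (α : ℝ → X → X) (x : X) : Set ℝ :=
  {γ | ∀ f : ℝ → ℂ, Integrable f → smear α f x = 0 → fourierT f γ = 0}

/-- Spectral subspace associated with a closed set `F ⊆ ℝ`. -/
def specC (α : ℝ → X → X) (F : Set ℝ) : Set X := {x | elemSpec α x ⊆ F}

/-- Spectral subspace of the subset `S` associated with an open set `U ⊆ ℝ`. -/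
def specO (α : ℝ → X → X) (S : Set X) (U : Set ℝ) : Set X :=
  ClosedSpan {y | ∃ x ∈ S, ∃ f : ℝ → ℂ, Integrable f ∧
    IsCompact (tsupport (fourierT f)) ∧ tsupport (fourierT f) ⊆ U ∧ y = smear α f x}

/-- The fixed point algebra `X^α`. -/
def fixedPts (α : ℝ → X → X) : Set X := {x | ∀ t, α t x = x}

/-- The Arveson spectrum of the action restricted to `S`. -/
def actSpec (α : ℝ → X → X) (S : Set X) : Set ℝ :=
  {γ : ℝ | ∀ ε > (0 : ℝ), S ∩ specC α (Icc (γ - ε) (γ + ε)) ≠ ({0} : Set X)}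

def Invariant (α : ℝ → X → X) (S : Set X) : Prop := ∀ t : ℝ, ∀ x ∈ S, α t x ∈ S

def IsSubalgebra (B : Set X) : Prop :=
  (0 : X) ∈ B ∧ (∀ x ∈ B, ∀ y ∈ B, x + y ∈ B) ∧
  (∀ c : ℂ, ∀ x ∈ B, c • x ∈ B) ∧ ∀ x ∈ B, ∀ y ∈ B, x * y ∈ B

def IsStarSubalgebra (B : Set X) : Prop := IsSubalgebra B ∧ ∀ x ∈ B, star x ∈ B

/-- `B` is a hereditary C*-subalgebra of the subset `S`. -/
def IsHereditaryIn (S B : Set X) : Prop :=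
  B ⊆ S ∧ IsClosed B ∧ IsStarSubalgebra B ∧
  ∀ x ∈ S, ∀ b ∈ B, 0 ≤ x → x ≤ b → x ∈ B

/-- `K` is a norm-closed two-sided ideal of the subset `S`. -/
def IsClosedTwoSidedIdealIn (S K : Set X) : Prop :=
  K ⊆ S ∧ IsClosed K ∧ (0 : X) ∈ K ∧ (∀ x ∈ K, ∀ y ∈ K, x + y ∈ K) ∧
  (∀ c : ℂ, ∀ x ∈ K, c • x ∈ K) ∧ ∀ s ∈ S, ∀ k ∈ K, s * k ∈ K ∧ k * s ∈ K

/-- `S` is `α`-simple: no nontrivial norm-closed `α`-invariant two-sided ideals. -/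
def AlphaSimple (α : ℝ → X → X) (S : Set X) : Prop :=
  ∀ K : Set X, IsClosedTwoSidedIdealIn S K → Invariant α K → K = ({0} : Set X) ∨ K = S

/-- The strong Arveson spectrum of the action restricted to `B`. -/
def strongSpec (α : ℝ → X → X) (B : Set X) : Set ℝ :=
  {γ : ℝ | ∀ ε > (0 : ℝ),
    ClosedSpan (MulSet3 (star '' (B ∩ specC α (Icc (γ - ε) (γ + ε)))) B
      (B ∩ specC α (Icc (γ - ε) (γ + ε)))) = B}

/-- The strong Connes spectrum of the action restricted to `S`. -/
def ConnesSpec (α : ℝ → X → X) (S : Set X) : Set ℝ :=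
  ⋂ B ∈ {B : Set X | IsHereditaryIn S B ∧ B ≠ ({0} : Set X) ∧ Invariant α B},
    strongSpec α B

def IsMaximalClosedSubalgebra (B : Set X) : Prop :=
  IsClosed B ∧ IsSubalgebra B ∧ B ≠ (univ : Set X) ∧
  ∀ W : Set X, IsClosed W → IsSubalgebra W → B ⊆ W → W = B ∨ W = univ

/-- The spectral Condition 4.3. -/
def Condition43 (α : ℝ → X → X) : Prop :=
  (∃ γ₀ : ℝ, 0 < γ₀ ∧ actSpec α (univ : Set X) = ({-γ₀, 0, γ₀} : Set ℝ) ∧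
    IsClosedTwoSidedIdealIn (fixedPts α)
      (ClosedSpan (MulSet2 (specC α ({γ₀} : Set ℝ)) (star '' specC α ({γ₀} : Set ℝ)))) ∧
    ∀ K : Set X,
      IsClosedTwoSidedIdealIn
        (ClosedSpan (MulSet2 (specC α ({γ₀} : Set ℝ)) (star '' specC α ({γ₀} : Set ℝ)))) K →
      K = ({0} : Set X) ∨
        K = ClosedSpan (MulSet2 (specC α ({γ₀} : Set ℝ)) (star '' specC α ({γ₀} : Set ℝ)))) ∨
  (∃ Y : Set X, IsClosedTwoSidedIdealIn (univ : Set X) Y ∧ Invariant α Y ∧ AlphaSimple α Y ∧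
    specO α Y (Ioi (0 : ℝ)) = specO α (univ : Set X) (Ioi (0 : ℝ)) ∧
    actSpec α Y = ConnesSpec α Y ∧
    closure (Y + specC α (Ici (0 : ℝ))) = (univ : Set X))

open scoped FourierTransform SchwartzMap Convolution ContDiff

section Smearing

variable {A : Type*} [NonUnitalCStarAlgebra A] {α : ℝ → A → A}

namespace IsCStarDynSys

lemma map_zero (hα : IsCStarDynSys α) (t : ℝ) : α t 0 = 0 := by
  simpa using hα.map_smulc t 0 0

lemma norm_apply_le (hα : IsCStarDynSys α) (t : ℝ) (x : A) : ‖α t x‖ ≤ ‖x‖ := by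
  let φ : A →⋆ₙₐ[ℂ] A :=
    { toFun := α t
      map_smul' := hα.map_smulc t
      map_zero' := hα.map_zero t
      map_add' := hα.map_add t
      map_mul' := hα.map_mul t
      map_star' := hα.map_star t }
  exact NonUnitalStarAlgHom.norm_apply_le φ x

/-- The automorphism `α t` as a continuous linear map. -/
def timeCLM (hα : IsCStarDynSys α) (t : ℝ) : A →L[ℂ] A :=
  LinearMap.mkContinuous ⟨⟨α t, hα.map_add t⟩, hα.map_smulc t⟩ 1
    fun x => by simpa using hα.norm_apply_le t x

lemma timeCLM_apply (hα : IsCStarDynSys α) (t : ℝ) (x : A) : hα.timeCLM t x = α t x := rfl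

lemma integrable_orbit (hα : IsCStarDynSys α) {f : ℝ → ℂ} (hf : Integrable f) (x : A) :
    Integrable fun t => f t • α t x := by
  refine (hf.norm.mul_const ‖x‖).mono'
    (hf.aestronglyMeasurable.smul (hα.continuous_orbit x).aestronglyMeasurable)
    (ae_of_all _ fun t => ?_)
  rw [norm_smul]
  exact mul_le_mul_of_nonneg_left (hα.norm_apply_le t x) (norm_nonneg _)

lemma norm_smear_le (hα : IsCStarDynSys α) {f : ℝ → ℂ} (hf : Integrable f) (x : A) :
    ‖smear α f x‖ ≤ (∫ t, ‖f t‖) * ‖x‖ := by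
  rw [← integral_mul_const]
  refine norm_integral_le_of_norm_le (hf.norm.mul_const ‖x‖) (ae_of_all _ fun t => ?_)
  rw [norm_smul]
  exact mul_le_mul_of_nonneg_left (hα.norm_apply_le t x) (norm_nonneg _)

/-- Smearing by an integrable function, as a continuous linear map. -/
def smearCLM (hα : IsCStarDynSys α) {f : ℝ → ℂ} (hf : Integrable f) : A →L[ℂ] A :=
  LinearMap.mkContinuous
    { toFun := smear α f
      map_add' := fun x y => by
        simp only [smear, hα.map_add, smul_add]
        exact integral_add (hα.integrable_orbit hf x) (hα.integrable_orbit hf y)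
      map_smul' := fun c x => by
        simp only [smear, hα.map_smulc, smul_comm _ c, RingHom.id_apply]
        exact integral_smul c _ }
    (∫ t, ‖f t‖) (hα.norm_smear_le hf)

lemma smearCLM_apply (hα : IsCStarDynSys α) {f : ℝ → ℂ} (hf : Integrable f) (x : A) :
    hα.smearCLM hf x = smear α f x := rfl

lemma smear_time (hα : IsCStarDynSys α) {f : ℝ → ℂ} (hf : Integrable f) (s : ℝ) (x : A) :
    smear α f (α s x) = α s (smear α f x) := by
  have h := (hα.timeCLM s).integral_comp_comm (hα.integrable_orbit hf x)
  rw [timeCLM_apply] at h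
  rw [smear, smear, ← h]
  congr 1 with t
  rw [timeCLM_apply, hα.map_smulc, ← hα.map_add_time, ← hα.map_add_time, add_comm]

lemma time_smear (hα : IsCStarDynSys α) {f : ℝ → ℂ} (hf : Integrable f) (s : ℝ) (x : A) :
    α s (smear α f x) = ∫ t, f (t - s) • α t x := by
  rw [← integral_add_right_eq_self (fun t => f (t - s) • α t x) s, ← hα.smear_time hf, smear]
  congr 1 with t
  rw [add_sub_cancel_right, hα.map_add_time]

lemma smear_comm (hα : IsCStarDynSys α) {f g : ℝ → ℂ} (hf : Integrable f) (hg : Integrable g)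
    (x : A) : smear α f (smear α g x) = smear α g (smear α f x) := by
  have h := (hα.smearCLM hg).integral_comp_comm (hα.integrable_orbit hf x)
  rw [smearCLM_apply] at h
  rw [← smear.eq_1 α f x] at h
  rw [← h, smear]
  congr 1 with t
  rw [map_smul, smearCLM_apply, hα.smear_time hg]

lemma smear_convolution (hα : IsCStarDynSys α) {f g : ℝ → ℂ} (hf : Integrable f)
    (hg : Integrable g) (x : A) :
    smear α (f ⋆[ContinuousLinearMap.mul ℂ ℂ] g) x = smear α f (smear α g x) := by
  have hint : Integrable (Function.uncurry fun t s : ℝ => (f s * g (t - s)) • α t x)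
      (volume.prod volume) := by
    have h := hf.convolution_integrand (ContinuousLinearMap.mul ℂ ℂ) hg
    refine (h.norm.mul_const ‖x‖).mono' (h.aestronglyMeasurable.smul
      ((hα.continuous_orbit x).comp continuous_fst).aestronglyMeasurable)
      (ae_of_all _ fun p => ?_)
    simp only [Function.uncurry, norm_smul, ContinuousLinearMap.mul_apply']
    exact mul_le_mul_of_nonneg_left (hα.norm_apply_le _ x) (norm_nonneg _)
  have h1 : smear α (f ⋆[ContinuousLinearMap.mul ℂ ℂ] g) x
      = ∫ t, ∫ s, (f s * g (t - s)) • α t x := by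
    rw [smear]
    congr 1 with t
    rw [convolution_def, ← integral_smul_const]
    rfl
  rw [h1, integral_integral_swap hint, smear]
  congr 1 with s
  rw [hα.time_smear hg, ← integral_smul]
  simp only [mul_smul]

end IsCStarDynSys

/-- Smearing by the inverse Fourier transform of a Schwartz function. -/
def fsmear (α : ℝ → A → A) (φ : 𝓢(ℝ, ℂ)) (x : A) : A := smear α (𝓕⁻ φ : 𝓢(ℝ, ℂ)) x

namespace IsCStarDynSys

lemma fsmear_mul (hα : IsCStarDynSys α) {φ ψ χ : 𝓢(ℝ, ℂ)} (h : ∀ ξ, χ ξ = φ ξ * ψ ξ) (x : A) :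
    fsmear α χ x = fsmear α φ (fsmear α ψ x) := by
  rw [fsmear, fsmear, fsmear, ← hα.smear_convolution (𝓕⁻ φ).integrable (𝓕⁻ ψ).integrable]
  congr 1
  ext t
  rw [← SchwartzMap.convolution_apply]
  congr 1
  have : χ = SchwartzMap.pairing (ContinuousLinearMap.mul ℂ ℂ) φ ψ := by
    ext ξ
    simp [h]
  rw [this, SchwartzMap.convolution]
  simp

/-- Smearing by the inverse Fourier transform of a Schwartz function, as a continuous
linear map. -/
def fsmearCLM (hα : IsCStarDynSys α) (φ : 𝓢(ℝ, ℂ)) : A →L[ℂ] A :=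
  hα.smearCLM (𝓕⁻ φ).integrable

lemma fsmearCLM_apply (hα : IsCStarDynSys α) (φ : 𝓢(ℝ, ℂ)) (x : A) :
    hα.fsmearCLM φ x = fsmear α φ x := rfl

lemma fsmear_add (hα : IsCStarDynSys α) (φ ψ : 𝓢(ℝ, ℂ)) (x : A) :
    fsmear α (φ + ψ) x = fsmear α φ x + fsmear α ψ x := by
  rw [fsmear, fsmear, fsmear, smear, smear, smear, FourierTransform.fourierInv_add,
    ← integral_add (hα.integrable_orbit (𝓕⁻ φ).integrable x)
      (hα.integrable_orbit (𝓕⁻ ψ).integrable x)]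
  simp only [add_apply, add_smul]

lemma _root_.PeligradMax.fsmear_of_fixed (φ : 𝓢(ℝ, ℂ)) {x : A} (hx : x ∈ fixedPts α) :
    fsmear α φ x = φ 0 • x := by
  have h : φ 0 = ∫ t, (𝓕⁻ φ : 𝓢(ℝ, ℂ)) t := by
    conv_lhs => rw [← FourierTransform.fourier_fourierInv_eq (F := 𝓢(ℝ, ℂ)) φ]
    rw [SchwartzMap.fourier_coe, Real.fourier_real_eq]
    simp
  rw [fsmear, smear, h, ← integral_smul_const]
  congr 1 with t
  rw [hx t]

end IsCStarDynSys

lemma exists_cutoff {K U : Set ℝ} (hK : IsCompact K) (hU : IsOpen U) (hKU : K ⊆ U) :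
    ∃ χ : 𝓢(ℝ, ℂ), HasCompactSupport χ ∧ tsupport χ ⊆ U ∧ ∀ ξ ∈ K, χ ξ = 1 := by
  obtain ⟨L, hL, hKL, hLU⟩ := exists_compact_between hK hU hKU
  obtain ⟨f, hf, -, hsupp, hone⟩ := exists_contMDiff_support_eq_eq_one_iff (n := ⊤)
    (modelWithCornersSelf ℝ ℝ) isOpen_interior hK.isClosed hKL
  have hsub : tsupport (fun ξ => (f ξ : ℂ)) ⊆ L := by
    refine closure_minimal (fun ξ hξ => interior_subset (hsupp ▸ ?_)) hL.isClosed
    simpa using hξ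
  have hc : HasCompactSupport fun ξ => (f ξ : ℂ) := hL.of_isClosed_subset (isClosed_tsupport _) hsub
  have hd : ContDiff ℝ ∞ fun ξ => (f ξ : ℂ) := Complex.ofRealCLM.contDiff.comp hf.contDiff
  refine ⟨hc.toSchwartzMap hd, hc, hsub.trans hLU, fun ξ hξ => ?_⟩
  change (f ξ : ℂ) = 1
  rw [(hone ξ).1 hξ, Complex.ofReal_one]

/-- The pointwise product of two Schwartz functions. -/
def smul2 (φ ψ : 𝓢(ℝ, ℂ)) : 𝓢(ℝ, ℂ) := SchwartzMap.pairing (ContinuousLinearMap.mul ℂ ℂ) φ ψ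

lemma smul2_apply (φ ψ : 𝓢(ℝ, ℂ)) (ξ : ℝ) : smul2 φ ψ ξ = φ ξ * ψ ξ := rfl

/-- A Schwartz function recentred at `ξ₀` and stretched by the factor `δ`. -/
lemma exists_rescale (χ : 𝓢(ℝ, ℂ)) (ξ₀ : ℝ) {δ : ℝ} (hδ : 0 < δ) :
    ∃ ψ : 𝓢(ℝ, ℂ), (∀ ξ, ψ ξ = χ ((ξ - ξ₀) / δ)) ∧
      (HasCompactSupport χ → HasCompactSupport ψ) ∧
      ∀ t, (𝓕⁻ ψ : 𝓢(ℝ, ℂ)) t =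
        δ * (Complex.exp (2 * Real.pi * Complex.I * t * ξ₀) * (𝓕⁻ χ : 𝓢(ℝ, ℂ)) (δ * t)) := by
  let e : ℝ ≃L[ℝ] ℝ := ContinuousLinearEquiv.unitsEquivAut ℝ (Units.mk0 δ⁻¹ (inv_ne_zero hδ.ne'))
  let ψ : 𝓢(ℝ, ℂ) := SchwartzMap.compSubConstCLM ℂ ξ₀
    (SchwartzMap.compCLMOfContinuousLinearEquiv ℂ e χ)
  have hψ : ∀ ξ, ψ ξ = χ ((ξ - ξ₀) / δ) := fun ξ => by
    simp [ψ, e, div_eq_mul_inv]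
  refine ⟨ψ, hψ, fun hc => ?_, fun t => ?_⟩
  · have h := hc.comp_homeomorph ((Homeomorph.subRight ξ₀).trans e.toHomeomorph)
    convert h using 1
    ext ξ
    simp [hψ, e, div_eq_mul_inv]
  · rw [SchwartzMap.fourierInv_coe, SchwartzMap.fourierInv_coe, Real.fourierInv_eq',
      Real.fourierInv_eq']
    simp only [hψ]
    rw [← integral_add_right_eq_self _ ξ₀]
    simp only [add_sub_cancel_right]
    have h := Measure.integral_comp_div (fun ξ : ℝ =>
      Complex.exp (↑(2 * Real.pi * inner ℝ (δ * ξ + ξ₀) t) * Complex.I) • χ ξ) δ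
    have h2 : ∀ ξ : ℝ, δ * (ξ / δ) = ξ := fun ξ => by field_simp
    simp only [h2] at h
    rw [h, abs_of_pos hδ, Complex.real_smul]
    congr 1
    rw [← integral_const_mul]
    refine integral_congr_ae (ae_of_all _ fun ξ => ?_)
    simp only [smul_eq_mul, ← mul_assoc, ← Complex.exp_add]
    congr 2
    simp
    ring

lemma exists_translate_decay (g : 𝓢(ℝ, ℂ)) :
    ∃ C : ℝ, ∀ r u : ℝ, |r| ≤ 1 → ‖g (u - r)‖ ≤ C * (1 + u ^ 2)⁻¹ := by
  obtain ⟨C₀, -, h₀⟩ := g.decay 0 0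
  obtain ⟨C₂, -, h₂⟩ := g.decay 2 0
  refine ⟨3 * (C₀ + C₂), fun r u hr => ?_⟩
  have a := h₀ (u - r)
  have b := h₂ (u - r)
  simp only [pow_zero, one_mul, norm_iteratedFDeriv_zero, Real.norm_eq_abs, sq_abs] at a b
  rw [← div_eq_mul_inv, le_div_iff₀ (by positivity)]
  have h3 : 1 + u ^ 2 ≤ 3 * (1 + (u - r) ^ 2) := by
    nlinarith [sq_nonneg (u - 2 * r), (sq_le_one_iff_abs_le_one r).2 hr]
  nlinarith [mul_le_mul_of_nonneg_left h3 (norm_nonneg (g (u - r)))]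

/-- The `L¹` modulus of continuity. -/
def transMod (g : 𝓢(ℝ, ℂ)) (r : ℝ) : ℝ := ∫ u, ‖g (u - r) - g u‖

lemma integrable_translate_sub (g : 𝓢(ℝ, ℂ)) (r : ℝ) :
    Integrable fun u => g (u - r) - g u :=
  (g.integrable.comp_sub_right r).sub g.integrable

lemma transMod_nonneg (g : 𝓢(ℝ, ℂ)) (r : ℝ) : 0 ≤ transMod g r :=
  integral_nonneg fun _ => norm_nonneg _

lemma transMod_le (g : 𝓢(ℝ, ℂ)) (r : ℝ) : transMod g r ≤ 2 * ∫ u, ‖g u‖ := by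
  have h : transMod g r ≤ ∫ u, (‖g (u - r)‖ + ‖g u‖) :=
    integral_mono (integrable_translate_sub g r).norm
      ((g.integrable.comp_sub_right r).norm.add g.integrable.norm) fun u => norm_sub_le _ _
  rw [integral_add (g.integrable.comp_sub_right r).norm g.integrable.norm,
    integral_sub_right_eq_self (fun u => ‖g u‖) r] at h
  linarith

lemma stronglyMeasurable_transMod (g : 𝓢(ℝ, ℂ)) : StronglyMeasurable (transMod g) := by
  have h : Continuous fun p : ℝ × ℝ => ‖g (p.2 - p.1) - g p.2‖ := by
    have := g.continuous
    fun_prop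
  exact h.stronglyMeasurable.integral_prod_right'

lemma tendsto_transMod (g : 𝓢(ℝ, ℂ)) : Tendsto (transMod g) (𝓝 0) (𝓝 0) := by
  obtain ⟨C, hC⟩ := exists_translate_decay g
  have hz : (0 : ℝ) = ∫ _ : ℝ, (0 : ℝ) := by simp
  rw [hz]
  conv => enter [2]; rw [← hz]
  refine tendsto_integral_filter_of_dominated_convergence
    (fun u => 2 * (C * (1 + u ^ 2)⁻¹)) ?_ ?_ ?_ ?_
  · exact Eventually.of_forall fun r => (integrable_translate_sub g r).norm.aestronglyMeasurable
  · filter_upwards [Metric.ball_mem_nhds (0 : ℝ) one_pos] with r hr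
    refine ae_of_all _ fun u => ?_
    have h1 := hC r u (by simpa using (Metric.mem_ball.1 hr).le)
    have h2 := hC 0 u (by simp)
    rw [sub_zero] at h2
    rw [norm_norm]
    linarith [norm_sub_le (g (u - r)) (g u)]
  · exact (integrable_inv_one_add_sq.const_mul C).const_mul 2
  · refine ae_of_all _ fun u => ?_
    have h : Continuous fun r : ℝ => ‖g (u - r) - g u‖ := by
      have := g.continuous
      fun_prop
    simpa using h.tendsto 0

namespace IsCStarDynSys

lemma exists_tendsto_fsmear (hα : IsCStarDynSys α) :
    ∃ θ : ℕ → 𝓢(ℝ, ℂ), (∀ n, HasCompactSupport (θ n)) ∧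
      ∀ x : A, Tendsto (fun n => fsmear α (θ n) x) atTop (𝓝 x) := by
  obtain ⟨χ, hχ, -, hone⟩ := exists_cutoff (isCompact_singleton (x := (0 : ℝ))) isOpen_univ
    (subset_univ _)
  have hpos : ∀ n : ℕ, (0 : ℝ) < n + 1 := fun n => by positivity
  choose θ hθ hθc hθF using fun n : ℕ => exists_rescale χ 0 (hpos n)
  refine ⟨θ, fun n => hθc n hχ, fun x => ?_⟩
  set g : 𝓢(ℝ, ℂ) := 𝓕⁻ χ with hg
  have hint : ∫ u, g u = 1 := by
    rw [← hone 0 rfl]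
    conv_rhs => rw [← FourierTransform.fourier_fourierInv_eq (F := 𝓢(ℝ, ℂ)) χ]
    rw [SchwartzMap.fourier_coe, Real.fourier_real_eq]
    simp [hg]
  have h1 : ∀ n, fsmear α (θ n) x = ∫ u, g u • α (u / (n + 1)) x := fun n => by
    have h := Measure.integral_comp_mul_left (fun u => g u • α (u / (n + 1)) x) ((n : ℝ) + 1)
    rw [abs_of_pos (inv_pos.2 (hpos n)), eq_inv_smul_iff₀ (hpos n).ne', ← integral_smul] at h
    rw [← h, fsmear, smear]
    congr 1 with t
    rw [hθF, mul_div_cancel_left₀ _ (hpos n).ne', ← Complex.coe_smul, smul_smul]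
    simp [hg]
  have h2 : x = ∫ u, g u • x := by rw [integral_smul_const, hint, one_smul]
  simp only [h1]
  conv => enter [3]; rw [h2]
  refine tendsto_integral_of_dominated_convergence (fun u => ‖g u‖ * ‖x‖) (fun n => ?_)
    (g.integrable.norm.mul_const _) (fun n => ae_of_all _ fun u => ?_) (ae_of_all _ fun u => ?_)
  · exact (g.continuous.smul ((hα.continuous_orbit x).comp
      (continuous_id.div_const _))).aestronglyMeasurable
  · rw [norm_smul]
    exact mul_le_mul_of_nonneg_left (hα.norm_apply_le _ x) (norm_nonneg _)
  · have h3 : Tendsto (fun n : ℕ => u / ((n : ℝ) + 1)) atTop (𝓝 0) := by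
      have := (tendsto_one_div_add_atTop_nhds_zero_nat (𝕜 := ℝ)).const_mul u
      simpa [div_eq_mul_inv] using this
    have h4 := ((hα.continuous_orbit x).tendsto 0).comp h3
    rw [hα.map_zero_time] at h4
    exact h4.const_smul (g u)

lemma eq_zero_of_fsmear_eq_zero (hα : IsCStarDynSys α) {x : A}
    (h : ∀ φ : 𝓢(ℝ, ℂ), HasCompactSupport φ → fsmear α φ x = 0) : x = 0 := by
  obtain ⟨θ, hθ, hlim⟩ := hα.exists_tendsto_fsmear
  refine tendsto_nhds_unique (hlim x) ?_
  simp [h _ (hθ _)]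

end IsCStarDynSys

namespace IsCStarDynSys

lemma norm_time_sub_le (hα : IsCStarDynSys α) (χ : 𝓢(ℝ, ℂ)) {ψ : 𝓢(ℝ, ℂ)} {ξ₀ δ : ℝ}
    (hδ : 0 < δ) (hψ : ∀ t, (𝓕⁻ ψ : 𝓢(ℝ, ℂ)) t =
        δ * (Complex.exp (2 * Real.pi * Complex.I * t * ξ₀) * (𝓕⁻ χ : 𝓢(ℝ, ℂ)) (δ * t)))
    {y : A} (hy : fsmear α ψ y = y) (t : ℝ) :
    ‖Complex.exp (-(2 * Real.pi * Complex.I * t * ξ₀)) • y - α t y‖ ≤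
      transMod (𝓕⁻ χ) (δ * t) * ‖y‖ := by
  set v : 𝓢(ℝ, ℂ) := 𝓕⁻ ψ with hv
  set c : ℂ := Complex.exp (-(2 * Real.pi * Complex.I * t * ξ₀)) with hc
  have hsm : smear α v y = y := hy
  have h1 : α t y = smear α (fun s => v (s - t)) y := by
    conv_lhs => rw [← hsm]
    rw [hα.time_smear v.integrable, smear]
  have h2 : c • y = smear α (fun s => c * v s) y := by
    conv_lhs => rw [← hsm]
    simp only [smear, mul_smul]
    rw [integral_smul]
  have i1 : Integrable fun s => v (s - t) := v.integrable.comp_sub_right t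
  have i2 : Integrable fun s => c * v s := v.integrable.const_mul c
  have h3 : c • y - α t y = smear α (fun s => c * v s - v (s - t)) y := by
    rw [h1, h2, smear, smear, smear,
      ← integral_sub (hα.integrable_orbit i2 y) (hα.integrable_orbit i1 y)]
    simp only [sub_smul]
  rw [h3]
  refine (hα.norm_smear_le (i2.sub i1) y).trans (le_of_eq ?_)
  congr 1
  have h4 := Measure.integral_comp_mul_left
    (fun u => ‖(𝓕⁻ χ : 𝓢(ℝ, ℂ)) (u - δ * t) - (𝓕⁻ χ : 𝓢(ℝ, ℂ)) u‖) δ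
  rw [abs_of_pos (inv_pos.2 hδ), eq_inv_smul_iff₀ hδ.ne', ← integral_smul] at h4
  rw [transMod, ← h4]
  congr 1 with s
  have h5 : c * v s - v (s - t) = δ * (Complex.exp (2 * Real.pi * Complex.I * (s - t) * ξ₀) *
      ((𝓕⁻ χ : 𝓢(ℝ, ℂ)) (δ * s) - (𝓕⁻ χ : 𝓢(ℝ, ℂ)) (δ * s - δ * t))) := by
    have h6 : Complex.exp (2 * Real.pi * Complex.I * (s - t) * ξ₀) =
        c * Complex.exp (2 * Real.pi * Complex.I * s * ξ₀) := by
      rw [hc, ← Complex.exp_add]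
      congr 1
      ring
    have h7 := hψ (s - t)
    push_cast at h7
    rw [hψ, h7, h6, mul_sub]
    ring
  change ‖c * v s - v (s - t)‖ = _
  rw [h5, norm_mul, norm_mul, Complex.norm_real, Real.norm_of_nonneg hδ.le, norm_sub_rev]
  have h8 : ‖Complex.exp (2 * Real.pi * Complex.I * (s - t) * ξ₀)‖ = 1 := by
    rw [Complex.norm_exp]
    simp
  rw [h8, one_mul, smul_eq_mul]

lemma exists_fsmear_eq_zero_near (hα : IsCStarDynSys α) {x : A} {γ : ℝ}
    (hγ : γ ∉ elemSpec α x) :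
    ∃ δ > 0, ∀ φ : 𝓢(ℝ, ℂ), tsupport φ ⊆ Metric.ball (γ / (2 * Real.pi)) δ →
      fsmear α φ x = 0 := by
  simp only [elemSpec, Set.mem_ofPred_eq, not_forall] at hγ
  obtain ⟨f, hf, hfx, hfγ⟩ := hγ
  obtain ⟨χ, -, -, hone⟩ := exists_cutoff (isCompact_Icc (a := (-1 : ℝ)) (b := 1)) isOpen_univ
    (subset_univ _)
  set ξ₀ := γ / (2 * Real.pi) with hξ₀
  set g : 𝓢(ℝ, ℂ) := 𝓕⁻ χ with hg
  have hmeas : ∀ δ : ℝ, AEStronglyMeasurable (fun t => ‖f t‖ * transMod g (δ * t)) :=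
    fun δ => hf.norm.aestronglyMeasurable.mul
      ((stronglyMeasurable_transMod g).comp_measurable
        (measurable_const_mul δ)).aestronglyMeasurable
  have hbd : ∀ δ t : ℝ, ‖‖f t‖ * transMod g (δ * t)‖ ≤ ‖f t‖ * (2 * ∫ u, ‖g u‖) := fun δ t => by
    rw [Real.norm_of_nonneg (mul_nonneg (norm_nonneg _) (transMod_nonneg _ _))]
    exact mul_le_mul_of_nonneg_left (transMod_le _ _) (norm_nonneg _)
  have hlim : Tendsto (fun δ : ℝ => ∫ t, ‖f t‖ * transMod g (δ * t)) (𝓝[>] 0) (𝓝 0) := by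
    have hz : (0 : ℝ) = ∫ _ : ℝ, (0 : ℝ) := by simp
    conv => enter [3]; rw [hz]
    refine tendsto_integral_filter_of_dominated_convergence _ (Eventually.of_forall hmeas)
      (Eventually.of_forall fun δ => ae_of_all _ (hbd δ)) (hf.norm.mul_const _)
      (ae_of_all _ fun t => ?_)
    have h1 : Tendsto (fun δ : ℝ => δ * t) (𝓝[>] 0) (𝓝 0) := by
      have : Tendsto (fun δ : ℝ => δ * t) (𝓝 0) (𝓝 (0 * t)) := tendsto_id.mul_const t
      rw [zero_mul] at this
      exact this.mono_left nhdsWithin_le_nhds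
    simpa using ((tendsto_transMod g).comp h1).const_mul ‖f t‖
  obtain ⟨δ, hδlt, hδ⟩ := ((hlim.eventually_lt_const (norm_pos_iff.2 hfγ)).and
    self_mem_nhdsWithin).exists
  have hδ : 0 < δ := hδ
  obtain ⟨ψ, hψ, -, hψF⟩ := exists_rescale χ ξ₀ hδ
  refine ⟨δ, hδ, fun φ hφ => ?_⟩
  set y := fsmear α φ x with hy
  have hψy : fsmear α ψ y = y := by
    rw [hy, ← hα.fsmear_mul (χ := φ)]
    intro ξ
    by_cases h : φ ξ = 0
    · simp [h]
    · have hb := hφ (subset_tsupport _ h)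
      rw [Metric.mem_ball, Real.dist_eq] at hb
      rw [hψ, hone, one_mul]
      rw [mem_Icc, ← abs_le, abs_div, abs_of_pos hδ, div_le_one hδ]
      exact hb.le
  have hfy : smear α f y = 0 := by
    rw [hy, fsmear, hα.smear_comm hf (𝓕⁻ φ).integrable, hfx]
    exact _root_.map_zero (hα.smearCLM (𝓕⁻ φ).integrable)
  have hest := hα.norm_time_sub_le χ hδ hψF hψy
  have hexp : ∀ t : ℝ, Complex.exp (-(Complex.I * γ * t)) =
      Complex.exp (-(2 * Real.pi * Complex.I * t * ξ₀)) := fun t => by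
    congr 2
    rw [hξ₀]
    have : (Real.pi : ℂ) ≠ 0 := by exact_mod_cast Real.pi_ne_zero
    push_cast
    field_simp
  have hfe : Integrable fun t : ℝ => f t * Complex.exp (-(Complex.I * γ * t)) := by
    refine hf.norm.mono' (hf.aestronglyMeasurable.mul
      (by fun_prop : Continuous fun t : ℝ =>
        Complex.exp (-(Complex.I * γ * t))).aestronglyMeasurable) (ae_of_all _ fun t => ?_)
    rw [norm_mul, Complex.norm_exp]
    simp
  have hkey : fourierT f γ • y = ∫ t, f t •
      (Complex.exp (-(2 * Real.pi * Complex.I * t * ξ₀)) • y - α t y) := by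
    have h1 : fourierT f γ • y = ∫ t : ℝ, (f t * Complex.exp (-(Complex.I * γ * t))) • y := by
      rw [integral_smul_const, fourierT]
    have h2 : fourierT f γ • y = fourierT f γ • y - smear α f y := by rw [hfy, sub_zero]
    rw [h2, h1, smear, ← integral_sub (hfe.smul_const y) (hα.integrable_orbit hf y)]
    simp only [hexp, mul_smul, smul_sub]
  have hle : ‖fourierT f γ‖ * ‖y‖ ≤ (∫ t, ‖f t‖ * transMod g (δ * t)) * ‖y‖ := by
    rw [← norm_smul, hkey, ← integral_mul_const]
    refine norm_integral_le_of_norm_le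
      (((hf.norm.mul_const _).mono' (hmeas δ) (ae_of_all _ (hbd δ))).mul_const ‖y‖)
      (ae_of_all _ fun t => ?_)
    rw [norm_smul]
    exact (mul_le_mul_of_nonneg_left (hest t) (norm_nonneg _)).trans_eq (mul_assoc _ _ _).symm
  by_contra hne
  exact absurd hle (not_le.2 (mul_lt_mul_of_pos_right hδlt (norm_pos_iff.2 hne)))

lemma fsmear_eq_zero_of_union (hα : IsCStarDynSys α) {x : A} {U V : Set ℝ} (hU : IsOpen U)
    (hV : IsOpen V)
    (hUx : ∀ φ : 𝓢(ℝ, ℂ), HasCompactSupport φ → tsupport φ ⊆ U → fsmear α φ x = 0)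
    (hVx : ∀ φ : 𝓢(ℝ, ℂ), HasCompactSupport φ → tsupport φ ⊆ V → fsmear α φ x = 0)
    (φ : 𝓢(ℝ, ℂ)) (hφ : HasCompactSupport φ) (hs : tsupport φ ⊆ U ∪ V) : fsmear α φ x = 0 := by
  obtain ⟨L, hL, hKL, hLU⟩ := exists_compact_between (hφ.diff hV) hU
    (fun ξ hξ => (hs hξ.1).resolve_right hξ.2)
  obtain ⟨χ, hχ, hχU, hone⟩ := exists_cutoff hL hU hLU
  have h1 : tsupport (smul2 χ φ) ⊆ tsupport χ :=
    closure_mono fun ξ hξ => left_ne_zero_of_mul hξ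
  have h2 : tsupport (φ - smul2 χ φ : 𝓢(ℝ, ℂ)) ⊆ tsupport φ \ interior L := by
    refine closure_minimal (fun ξ hξ => ⟨subset_tsupport _ fun h => hξ ?_, fun h => hξ ?_⟩)
      ((isClosed_tsupport _).sdiff isOpen_interior)
    · simp [sub_apply, smul2_apply, h]
    · simp [sub_apply, smul2_apply, hone ξ (interior_subset h)]
  have h3 : fsmear α (smul2 χ φ) x = 0 :=
    hUx _ (hχ.of_isClosed_subset (isClosed_tsupport _) h1) (h1.trans hχU)
  have h4 : fsmear α (φ - smul2 χ φ) x = 0 :=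
    hVx _ (hφ.of_isClosed_subset (isClosed_tsupport _) (h2.trans sdiff_subset)) fun ξ hξ => by
      by_contra hn
      exact (h2 hξ).2 (hKL ⟨(h2 hξ).1, hn⟩)
  have h5 := hα.fsmear_add (φ - smul2 χ φ) (smul2 χ φ) x
  rwa [sub_add_cancel, h3, h4, add_zero] at h5

lemma fsmear_eq_zero_of_disjoint (hα : IsCStarDynSys α) {x : A} {φ : 𝓢(ℝ, ℂ)}
    (hφ : HasCompactSupport φ)
    (hd : ∀ ξ ∈ tsupport φ, 2 * Real.pi * ξ ∉ elemSpec α x) : fsmear α φ x = 0 := by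
  have key : ∃ U : Set ℝ, IsOpen U ∧ tsupport φ ⊆ U ∧
      ∀ φ : 𝓢(ℝ, ℂ), HasCompactSupport φ → tsupport φ ⊆ U → fsmear α φ x = 0 := by
    refine IsCompact.induction_on hφ (p := fun s => ∃ U : Set ℝ, IsOpen U ∧ s ⊆ U ∧
      ∀ φ : 𝓢(ℝ, ℂ), HasCompactSupport φ → tsupport φ ⊆ U → fsmear α φ x = 0) ?_ ?_ ?_ ?_
    · refine ⟨∅, isOpen_empty, subset_rfl, fun ψ _ hψ => ?_⟩
      have h0 : ψ = 0 := by
        ext ξ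
        by_contra h
        exact hψ (subset_tsupport _ h)
      have h := hα.fsmear_add ψ ψ x
      rw [h0, add_zero] at h
      rw [h0]
      simpa using h
    · rintro s t hst ⟨U, hU, htU, h⟩
      exact ⟨U, hU, hst.trans htU, h⟩
    · rintro s t ⟨U, hU, hsU, h⟩ ⟨V, hV, htV, h'⟩
      exact ⟨U ∪ V, hU.union hV, union_subset_union hsU htV, hα.fsmear_eq_zero_of_union hU hV h h'⟩
    · intro ξ hξ
      obtain ⟨δ, hδ, h⟩ := hα.exists_fsmear_eq_zero_near (hd ξ hξ)
      rw [mul_div_cancel_left₀ _ (by positivity)] at h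
      exact ⟨Metric.ball ξ δ, mem_nhdsWithin_of_mem_nhds (Metric.ball_mem_nhds _ hδ),
        Metric.ball ξ δ, Metric.isOpen_ball, subset_rfl, fun ψ _ hψ => h ψ hψ⟩
  obtain ⟨U, -, hφU, h⟩ := key
  exact h φ hφ hφU

end IsCStarDynSys

/-- The elements whose spectrum is compact and contained in `2π U`, recorded by a reproducing
Schwartz function. -/
def bandSet (α : ℝ → A → A) (U : Set ℝ) : Set A :=
  {x | ∃ φ : 𝓢(ℝ, ℂ), HasCompactSupport φ ∧ tsupport φ ⊆ U ∧ fsmear α φ x = x}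

namespace IsCStarDynSys

lemma fsmear_mem_bandSet (hα : IsCStarDynSys α) {U : Set ℝ} (hU : IsOpen U) {φ : 𝓢(ℝ, ℂ)}
    (hφ : HasCompactSupport φ) (hφU : tsupport φ ⊆ U) (x : A) : fsmear α φ x ∈ bandSet α U := by
  obtain ⟨χ, hχ, hχU, hone⟩ := exists_cutoff hφ hU hφU
  refine ⟨χ, hχ, hχU, ?_⟩
  rw [← hα.fsmear_mul (χ := φ)]
  intro ξ
  by_cases h : φ ξ = 0
  · simp [h]
  · rw [hone ξ (subset_tsupport _ h), one_mul]

lemma mem_bandSet_of_specC (hα : IsCStarDynSys α) {U : Set ℝ} (hU : IsOpen U) {a b : ℝ}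
    (hab : Icc (a / (2 * Real.pi)) (b / (2 * Real.pi)) ⊆ U) {x : A}
    (hx : x ∈ specC α (Icc a b)) : x ∈ bandSet α U := by
  obtain ⟨L, hL, hKL, hLU⟩ := exists_compact_between isCompact_Icc hU hab
  obtain ⟨χ, hχ, hχU, hone⟩ := exists_cutoff hL hU hLU
  refine ⟨χ, hχ, hχU, sub_eq_zero.1 (hα.eq_zero_of_fsmear_eq_zero fun θ hθ => ?_)⟩
  have h2 : tsupport (smul2 θ χ - θ : 𝓢(ℝ, ℂ)) ⊆ tsupport θ \ interior L := by
    refine closure_minimal (fun ξ hξ => ⟨subset_tsupport _ fun h => hξ ?_, fun h => hξ ?_⟩)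
      ((isClosed_tsupport _).sdiff isOpen_interior)
    · simp [sub_apply, smul2_apply, h]
    · simp [sub_apply, smul2_apply, hone ξ (interior_subset h)]
  have h3 : fsmear α (smul2 θ χ - θ) x = 0 := by
    refine hα.fsmear_eq_zero_of_disjoint
      (hθ.of_isClosed_subset (isClosed_tsupport _) (h2.trans sdiff_subset)) fun ξ hξ hm => ?_
    have h4 := hx hm
    refine (h2 hξ).2 (hKL ⟨?_, ?_⟩)
    · rw [div_le_iff₀ (by positivity)]
      linarith [h4.1]
    · rw [le_div_iff₀ (by positivity)]
      linarith [h4.2]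
  have h5 := hα.fsmear_add (smul2 θ χ - θ) θ x
  rw [sub_add_cancel, h3, zero_add, hα.fsmear_mul (smul2_apply θ χ)] at h5
  rw [← hα.fsmearCLM_apply, map_sub, hα.fsmearCLM_apply, hα.fsmearCLM_apply, h5, sub_self]

end IsCStarDynSys

/-- Modulating a Schwartz function translates its Fourier transform. -/
lemma exists_modulate (u : 𝓢(ℝ, ℂ)) (s : ℝ) :
    ∃ v : 𝓢(ℝ, ℂ), (∀ ξ, u ξ = 0 → v ξ = 0) ∧
      ∀ t, (𝓕 v : 𝓢(ℝ, ℂ)) t = (𝓕⁻ u : 𝓢(ℝ, ℂ)) (s - t) := by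
  refine ⟨𝓕⁻ (SchwartzMap.compSubConstCLM ℂ s (𝓕 u : 𝓢(ℝ, ℂ))), fun ξ hξ => ?_, fun t => ?_⟩
  · have h : u ξ = ∫ t : ℝ, Complex.exp ((2 * Real.pi * (t * ξ) : ℝ) * Complex.I) •
        (𝓕 u : 𝓢(ℝ, ℂ)) t := by
      conv_lhs => rw [← FourierTransform.fourierInv_fourier_eq (F := 𝓢(ℝ, ℂ)) u]
      rw [SchwartzMap.fourierInv_coe, Real.fourierInv_eq']
      simp [mul_comm]
    have h2 : (𝓕⁻ (SchwartzMap.compSubConstCLM ℂ s (𝓕 u : 𝓢(ℝ, ℂ))) : 𝓢(ℝ, ℂ)) ξ =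
        Complex.exp ((2 * Real.pi * (s * ξ) : ℝ) * Complex.I) * u ξ := by
      rw [h, SchwartzMap.fourierInv_coe, Real.fourierInv_eq',
        ← integral_add_right_eq_self _ s, ← integral_const_mul]
      congr 1 with t
      simp only [SchwartzMap.compSubConstCLM_apply, add_sub_cancel_right, smul_eq_mul]
      rw [← mul_assoc, ← Complex.exp_add]
      congr 2
      simp
      ring
    rw [h2, hξ, mul_zero]
  · rw [FourierTransform.fourier_fourierInv_eq, SchwartzMap.compSubConstCLM_apply,
      SchwartzMap.fourierInv_coe, SchwartzMap.fourier_coe, Real.fourierInv_eq_fourier_neg, neg_sub]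

lemma integral_fourierInv_mul_mul {ψ u w : 𝓢(ℝ, ℂ)}
    (h : ∀ ξ ∈ tsupport u + tsupport w, ψ ξ = 1) (s r : ℝ) :
    ∫ t, (𝓕⁻ ψ : 𝓢(ℝ, ℂ)) t * (𝓕⁻ u : 𝓢(ℝ, ℂ)) (s - t) * (𝓕⁻ w : 𝓢(ℝ, ℂ)) (r - t) =
      (𝓕⁻ u : 𝓢(ℝ, ℂ)) s * (𝓕⁻ w : 𝓢(ℝ, ℂ)) r := by
  obtain ⟨u', hu', hus⟩ := exists_modulate u s
  obtain ⟨w', hw', hws⟩ := exists_modulate w r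
  set k : 𝓢(ℝ, ℂ) := SchwartzMap.convolution (ContinuousLinearMap.mul ℂ ℂ) u' w' with hk
  have hF : ∀ t, (𝓕 k : 𝓢(ℝ, ℂ)) t =
      (𝓕⁻ u : 𝓢(ℝ, ℂ)) (s - t) * (𝓕⁻ w : 𝓢(ℝ, ℂ)) (r - t) := fun t => by
    rw [hk, SchwartzMap.fourier_convolution, ← hus, ← hws]
    rfl
  have hk1 : ∀ ξ, ψ ξ * k ξ = k ξ := fun ξ => by
    by_cases h0 : k ξ = 0
    · simp [h0]
    · rw [h, one_mul]
      rw [hk, SchwartzMap.convolution_apply] at h0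
      have h1 := support_convolution_subset (ContinuousLinearMap.mul ℂ ℂ) h0
      refine add_subset_add ?_ ?_ h1
      · exact fun η hη => subset_tsupport _ fun hz => hη (hu' η hz)
      · exact fun η hη => subset_tsupport _ fun hz => hη (hw' η hz)
  have h2 : (𝓕 k : 𝓢(ℝ, ℂ)) 0 = ∫ ξ, k ξ := by
    rw [SchwartzMap.fourier_coe, Real.fourier_real_eq]
    simp
  have h3 := SchwartzMap.integral_fourier_mul_eq (𝓕⁻ ψ : 𝓢(ℝ, ℂ)) k
  rw [FourierTransform.fourier_fourierInv_eq] at h3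
  simp only [hk1, hF] at h3
  rw [← h2, hF, sub_zero, sub_zero] at h3
  rw [h3]
  simp only [mul_assoc]

namespace IsCStarDynSys

lemma smear_mul_translate (hα : IsCStarDynSys α) {ψ u w : 𝓢(ℝ, ℂ)}
    (h : ∀ ξ ∈ tsupport u + tsupport w, ψ ξ = 1) {y : A} (hy : fsmear α w y = y) (s : ℝ) :
    smear α (fun t => (𝓕⁻ ψ : 𝓢(ℝ, ℂ)) t * (𝓕⁻ u : 𝓢(ℝ, ℂ)) (s - t)) y =
      (𝓕⁻ u : 𝓢(ℝ, ℂ)) s • y := by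
  obtain ⟨C, -, hC⟩ := (𝓕⁻ u : 𝓢(ℝ, ℂ)).decay 0 0
  simp only [pow_zero, one_mul, norm_iteratedFDeriv_zero] at hC
  have hi : Integrable fun t => (𝓕⁻ ψ : 𝓢(ℝ, ℂ)) t * (𝓕⁻ u : 𝓢(ℝ, ℂ)) (s - t) := by
    have hc := (𝓕⁻ u : 𝓢(ℝ, ℂ)).continuous
    exact (𝓕⁻ ψ : 𝓢(ℝ, ℂ)).integrable.mul_bdd (c := C)
      (by fun_prop : Continuous fun t => (𝓕⁻ u : 𝓢(ℝ, ℂ)) (s - t)).aestronglyMeasurable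
      (ae_of_all _ fun t => hC _)
  have hy' : smear α (𝓕⁻ w : 𝓢(ℝ, ℂ)) y = y := hy
  conv_lhs => rw [← hy']
  rw [← hα.smear_convolution hi (𝓕⁻ w).integrable]
  conv_rhs => rw [← hy']
  rw [smear, smear, ← integral_smul]
  congr 1 with r
  rw [convolution_def, smul_smul]
  congr 1
  exact integral_fourierInv_mul_mul h s r

lemma fsmear_mul_eq (hα : IsCStarDynSys α) {ψ u w : 𝓢(ℝ, ℂ)}
    (h : ∀ ξ ∈ tsupport u + tsupport w, ψ ξ = 1) {x y : A} (hx : fsmear α u x = x)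
    (hy : fsmear α w y = y) : fsmear α ψ (x * y) = x * y := by
  have hx' : smear α (𝓕⁻ u : 𝓢(ℝ, ℂ)) x = x := hx
  have hux := hα.integrable_orbit (𝓕⁻ u : 𝓢(ℝ, ℂ)).integrable x
  have h1 : ∀ t, (𝓕⁻ ψ : 𝓢(ℝ, ℂ)) t • α t (x * y) =
      ∫ s, ((𝓕⁻ ψ : 𝓢(ℝ, ℂ)) t * (𝓕⁻ u : 𝓢(ℝ, ℂ)) (s - t)) • (α s x * α t y) := fun t => by
    have h2 := hα.time_smear (𝓕⁻ u : 𝓢(ℝ, ℂ)).integrable t x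
    rw [hx'] at h2
    rw [hα.map_mul, h2]
    have h3 : Integrable fun s => (𝓕⁻ u : 𝓢(ℝ, ℂ)) (s - t) • α s x :=
      hα.integrable_orbit ((𝓕⁻ u : 𝓢(ℝ, ℂ)).integrable.comp_sub_right t) x
    have h4 := ((ContinuousLinearMap.mul ℂ A).flip (α t y)).integral_comp_comm h3
    simp only [ContinuousLinearMap.flip_apply, ContinuousLinearMap.mul_apply'] at h4
    rw [← h4, ← integral_smul]
    simp only [mul_smul, smul_mul_assoc]
  have hint : Integrable (Function.uncurry fun t s : ℝ =>
      ((𝓕⁻ ψ : 𝓢(ℝ, ℂ)) t * (𝓕⁻ u : 𝓢(ℝ, ℂ)) (s - t)) • (α s x * α t y))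
      (volume.prod volume) := by
    have h5 : Integrable (fun p : ℝ × ℝ => (𝓕⁻ ψ : 𝓢(ℝ, ℂ)) p.1 * (𝓕⁻ u : 𝓢(ℝ, ℂ)) (p.2 - p.1))
        (volume.prod volume) :=
      (Integrable.convolution_integrand (ContinuousLinearMap.mul ℂ ℂ) (𝓕⁻ ψ).integrable
        (𝓕⁻ u).integrable).swap
    refine (h5.norm.mul_const (‖x‖ * ‖y‖)).mono' (h5.aestronglyMeasurable.smul
      (((hα.continuous_orbit x).comp continuous_snd).mul
        ((hα.continuous_orbit y).comp continuous_fst)).aestronglyMeasurable)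
      (ae_of_all _ fun p => ?_)
    rw [Function.uncurry, norm_smul]
    exact mul_le_mul_of_nonneg_left ((norm_mul_le _ _).trans
      (mul_le_mul (hα.norm_apply_le _ x) (hα.norm_apply_le _ y) (norm_nonneg _) (norm_nonneg _)))
      (norm_nonneg _)
  rw [fsmear, smear]
  simp only [h1]
  rw [integral_integral_swap hint]
  have h6 : ∀ s, ∫ t, ((𝓕⁻ ψ : 𝓢(ℝ, ℂ)) t * (𝓕⁻ u : 𝓢(ℝ, ℂ)) (s - t)) • (α s x * α t y) =
      (𝓕⁻ u : 𝓢(ℝ, ℂ)) s • (α s x * y) := fun s => by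
    have h7 := hα.smear_mul_translate h hy s
    rw [← mul_smul_comm, ← h7, smear]
    obtain ⟨C, -, hC⟩ := (𝓕⁻ u : 𝓢(ℝ, ℂ)).decay 0 0
    simp only [pow_zero, one_mul, norm_iteratedFDeriv_zero] at hC
    have hi : Integrable fun t => (𝓕⁻ ψ : 𝓢(ℝ, ℂ)) t * (𝓕⁻ u : 𝓢(ℝ, ℂ)) (s - t) := by
      have hc := (𝓕⁻ u : 𝓢(ℝ, ℂ)).continuous
      exact (𝓕⁻ ψ : 𝓢(ℝ, ℂ)).integrable.mul_bdd (c := C)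
        (by fun_prop : Continuous fun t => (𝓕⁻ u : 𝓢(ℝ, ℂ)) (s - t)).aestronglyMeasurable
        (ae_of_all _ fun t => hC _)
    have h8 := (ContinuousLinearMap.mul ℂ A (α s x)).integral_comp_comm
      (hα.integrable_orbit hi y)
    simp only [ContinuousLinearMap.mul_apply'] at h8
    rw [← h8]
    simp only [mul_smul_comm]
  simp only [h6]
  have h9 := ((ContinuousLinearMap.mul ℂ A).flip y).integral_comp_comm hux
  simp only [ContinuousLinearMap.flip_apply, ContinuousLinearMap.mul_apply',
    smul_mul_assoc] at h9
  rw [h9]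
  exact congrArg (· * y) hx'

lemma mul_mem_bandSet (hα : IsCStarDynSys α) {U V W : Set ℝ} (hW : IsOpen W) (hUV : U + V ⊆ W)
    {x y : A} (hx : x ∈ bandSet α U) (hy : y ∈ bandSet α V) : x * y ∈ bandSet α W := by
  obtain ⟨u, hu, huU, hux⟩ := hx
  obtain ⟨w, hw, hwV, hwy⟩ := hy
  obtain ⟨ψ, hψ, hψW, hone⟩ := exists_cutoff (hu.isCompact.add hw.isCompact) hW
    ((add_subset_add huU hwV).trans hUV)
  exact ⟨ψ, hψ, hψW, hα.fsmear_mul_eq hone hux hwy⟩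

end IsCStarDynSys

lemma exists_reflect (φ : 𝓢(ℝ, ℂ)) :
    ∃ ψ : 𝓢(ℝ, ℂ), tsupport ψ = -tsupport φ ∧
      ∀ t, (𝓕⁻ ψ : 𝓢(ℝ, ℂ)) t = (𝓕⁻ φ : 𝓢(ℝ, ℂ)) (-t) := by
  refine ⟨SchwartzMap.compCLMOfContinuousLinearEquiv ℂ (ContinuousLinearEquiv.neg ℝ) φ, ?_,
    fun t => ?_⟩
  · exact tsupport_comp_eq_preimage φ (Homeomorph.neg ℝ)
  · rw [SchwartzMap.fourierInv_coe, SchwartzMap.fourierInv_coe, Real.fourierInv_eq',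
      Real.fourierInv_eq', ← integral_neg_eq_self]
    simp

lemma exists_conj_reflect (φ : 𝓢(ℝ, ℂ)) :
    ∃ ψ : 𝓢(ℝ, ℂ), tsupport ψ = -tsupport φ ∧
      ∀ t, (𝓕⁻ ψ : 𝓢(ℝ, ℂ)) t = star ((𝓕⁻ φ : 𝓢(ℝ, ℂ)) t) := by
  obtain ⟨ρ, hρ, hρF⟩ := exists_reflect φ
  have hval : ∀ ξ, SchwartzMap.postcompCLM (Complex.conjCLE : ℂ →L[ℝ] ℂ) ρ ξ = star (ρ ξ) :=
    fun ξ => rfl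
  refine ⟨SchwartzMap.postcompCLM (Complex.conjCLE : ℂ →L[ℝ] ℂ) ρ, ?_, fun t => ?_⟩
  · rw [← hρ, tsupport, tsupport]
    congr 1
    ext ξ
    simp only [Function.mem_support, hval, ne_eq, star_eq_zero]
  · rw [← neg_neg t, ← hρF, SchwartzMap.fourierInv_coe, SchwartzMap.fourierInv_coe,
      Real.fourierInv_eq', Real.fourierInv_eq', Complex.star_def, ← integral_conj]
    congr 1 with ξ
    rw [hval, smul_eq_mul, smul_eq_mul, map_mul, ← Complex.exp_conj, map_mul, Complex.conj_ofReal]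
    simp

lemma bandSet_mono {U V : Set ℝ} (h : U ⊆ V) : bandSet α U ⊆ bandSet α V :=
  fun _ ⟨φ, hφ, hφU, hx⟩ => ⟨φ, hφ, hφU.trans h, hx⟩

lemma mem_bandSet_reverse {U : Set ℝ} {x : A} (hx : x ∈ bandSet α (-U)) :
    x ∈ bandSet (fun t => α (-t)) U := by
  obtain ⟨φ, hφ, hφU, hx⟩ := hx
  obtain ⟨ψ, hψ, hψF⟩ := exists_reflect φ
  refine ⟨ψ, ?_, ?_, ?_⟩
  · rw [HasCompactSupport, hψ]
    exact IsCompact.neg hφ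
  · rw [hψ]
    exact (neg_subset_neg.2 hφU).trans (neg_neg U).subset
  · conv_rhs => rw [← hx]
    rw [fsmear, smear, fsmear, smear, ← integral_neg_eq_self]
    simp [hψF]

lemma mem_bandSet_of_reverse {U : Set ℝ} {x : A} (hx : x ∈ bandSet (fun t => α (-t)) U) :
    x ∈ bandSet α (-U) := by
  rw [← neg_neg U] at hx
  simpa using mem_bandSet_reverse hx

lemma eq_zero_of_mem_bandSet_of_fixed {U : Set ℝ} (hU : 0 ∉ U) {x : A} (hx : x ∈ bandSet α U)
    (hfix : x ∈ fixedPts α) : x = 0 := by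
  obtain ⟨φ, -, hφU, hx⟩ := hx
  rw [← hx, fsmear_of_fixed φ hfix, image_eq_zero_of_notMem_tsupport fun h => hU (hφU h), zero_smul]

namespace IsCStarDynSys

lemma reverse (hα : IsCStarDynSys α) : IsCStarDynSys fun t => α (-t) where
  map_zero_time x := by simpa using hα.map_zero_time x
  map_add_time s t x := by rw [neg_add, hα.map_add_time]
  map_add t := hα.map_add (-t)
  map_smulc t := hα.map_smulc (-t)
  map_mul t := hα.map_mul (-t)
  map_star t := hα.map_star (-t)
  continuous_orbit x := (hα.continuous_orbit x).comp continuous_neg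

lemma star_mem_bandSet (hα : IsCStarDynSys α) {U : Set ℝ} {x : A} (hx : x ∈ bandSet α U) :
    star x ∈ bandSet α (-U) := by
  obtain ⟨φ, hφ, hφU, hx⟩ := hx
  obtain ⟨ψ, hψ, hψF⟩ := exists_conj_reflect φ
  refine ⟨ψ, ?_, ?_, ?_⟩
  · rw [HasCompactSupport, hψ]
    exact IsCompact.neg hφ
  · rw [hψ]
    exact neg_subset_neg.2 hφU
  · conv_rhs => rw [← hx]
    have h := (starL' ℝ : A ≃L[ℝ] A).integral_comp_comm
      (μ := volume) fun t => (𝓕⁻ φ : 𝓢(ℝ, ℂ)) t • α t x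
    simp only [starL'_apply] at h
    rw [fsmear, smear, fsmear, smear, ← h]
    simp only [hψF, star_smul, hα.map_star]

lemma time_mem_bandSet (hα : IsCStarDynSys α) {U : Set ℝ} {x : A} (hx : x ∈ bandSet α U)
    (s : ℝ) : α s x ∈ bandSet α U := by
  obtain ⟨φ, hφ, hφU, hx⟩ := hx
  refine ⟨φ, hφ, hφU, ?_⟩
  rw [fsmear, hα.smear_time (𝓕⁻ φ).integrable]
  exact congrArg (α s) hx

lemma fixed_mul_mem_bandSet (hα : IsCStarDynSys α) {U : Set ℝ} {z x : A}
    (hz : z ∈ fixedPts α) (hx : x ∈ bandSet α U) : z * x ∈ bandSet α U := by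
  obtain ⟨φ, hφ, hφU, hx⟩ := hx
  refine ⟨φ, hφ, hφU, ?_⟩
  conv_rhs => rw [← hx]
  have h := (ContinuousLinearMap.mul ℂ A z).integral_comp_comm
    (hα.integrable_orbit (𝓕⁻ φ).integrable x)
  simp only [ContinuousLinearMap.mul_apply'] at h
  rw [fsmear, smear, fsmear, smear, ← h]
  simp only [hα.map_mul, hz _, mul_smul_comm]

lemma mul_fixed_mem_bandSet (hα : IsCStarDynSys α) {U : Set ℝ} {z x : A}
    (hz : z ∈ fixedPts α) (hx : x ∈ bandSet α U) : x * z ∈ bandSet α U := by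
  obtain ⟨φ, hφ, hφU, hx⟩ := hx
  refine ⟨φ, hφ, hφU, ?_⟩
  conv_rhs => rw [← hx]
  have h := ((ContinuousLinearMap.mul ℂ A).flip z).integral_comp_comm
    (hα.integrable_orbit (𝓕⁻ φ).integrable x)
  simp only [ContinuousLinearMap.mul_apply', ContinuousLinearMap.flip_apply] at h
  rw [fsmear, smear, fsmear, smear, ← h]
  simp only [hα.map_mul, hz _, smul_mul_assoc]

lemma isClosed_fixedPts (hα : IsCStarDynSys α) : IsClosed (fixedPts α) := by
  have h : fixedPts α = ⋂ t, {x | hα.timeCLM t x = x} := by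
    ext x
    simp [fixedPts, timeCLM_apply]
  rw [h]
  exact isClosed_iInter fun t => isClosed_eq (hα.timeCLM t).continuous continuous_id

lemma mul_mem_fixedPts (hα : IsCStarDynSys α) {n p : A} (h : ∀ x, n * x * p ∈ fixedPts α) :
    n * p ∈ fixedPts α := by
  let _ : PartialOrder A := CStarAlgebra.spectralOrder A
  have : StarOrderedRing A := CStarAlgebra.spectralOrderedRing A
  have hu := (CStarAlgebra.increasingApproximateUnit A).toIsApproximateUnit
  exact hα.isClosed_fixedPts.mem_of_tendsto ((hu.tendsto_mul_left n).mul_const p)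
    (Eventually.of_forall h)

end IsCStarDynSys

/-- Splitting a compactly supported Schwartz function into parts supported on the negative
half-line, near the origin, and on the positive half-line. -/
lemma exists_split {φ : 𝓢(ℝ, ℂ)} (hφ : HasCompactSupport φ) {ε : ℝ} (hε : 0 < ε) :
    ∃ φm φ0 φp : 𝓢(ℝ, ℂ), φ = φm + φ0 + φp ∧
      (HasCompactSupport φm ∧ tsupport φm ⊆ Iio 0) ∧
      (HasCompactSupport φ0 ∧ tsupport φ0 ⊆ Metric.ball 0 ε) ∧
      (HasCompactSupport φp ∧ tsupport φp ⊆ Ioi 0) := by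
  obtain ⟨χ, hχ, hχU, hone⟩ := exists_cutoff (isCompact_Icc (a := -(ε / 2)) (b := ε / 2))
    (Metric.isOpen_ball (x := (0 : ℝ)) (ε := ε)) fun ξ hξ => by
      rw [Metric.mem_ball, dist_zero_right, Real.norm_eq_abs, abs_lt]
      constructor <;> linarith [hξ.1, hξ.2]
  have hK : IsCompact (tsupport φ ∩ Ici (ε / 2)) := hφ.isCompact.inter_right isClosed_Ici
  obtain ⟨η, hη, hηU, hone'⟩ := exists_cutoff hK (isOpen_Ioi (a := (0 : ℝ)))
    fun ξ hξ => (half_pos hε).trans_le hξ.2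
  have hc : ∀ {θ : 𝓢(ℝ, ℂ)}, (∀ ξ, φ ξ = 0 → θ ξ = 0) → HasCompactSupport θ := fun {θ} h =>
    hφ.of_isClosed_subset (isClosed_tsupport _) (closure_mono fun ξ hξ h0 => hξ (h ξ h0))
  refine ⟨φ - smul2 χ φ - smul2 η (φ - smul2 χ φ), smul2 χ φ, smul2 η (φ - smul2 χ φ), ?_,
    ⟨hc fun ξ h => ?_, ?_⟩, ⟨hc fun ξ h => ?_, ?_⟩, hc fun ξ h => ?_, ?_⟩
  · abel
  · simp [sub_apply, smul2_apply, h]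
  · refine (closure_minimal (fun ξ hξ => ?_) (isClosed_Iic (a := -(ε / 2)))).trans
      (Iic_subset_Iio.2 (by linarith))
    by_contra hn
    rw [mem_Iic, not_le] at hn
    refine hξ ?_
    simp only [sub_apply, smul2_apply]
    rcases le_total ξ (ε / 2) with h | h
    · rw [hone ξ ⟨hn.le, h⟩]
      ring
    · by_cases h0 : φ ξ = 0
      · simp [h0]
      · rw [hone' ξ ⟨subset_tsupport _ h0, h⟩]
        ring
  · simp [smul2_apply, h]
  · exact (closure_mono fun ξ hξ => left_ne_zero_of_mul hξ).trans hχU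
  · simp [sub_apply, smul2_apply, h]
  · exact (closure_mono fun ξ hξ => left_ne_zero_of_mul hξ).trans hηU

namespace IsCStarDynSys

lemma star_mul_mul_eq_zero_of_bandSet (hα : IsCStarDynSys α)
    (H : ∀ n ∈ bandSet α (Iio 0), ∀ x, ∀ p ∈ bandSet α (Ioi 0), n * x * p ∈ fixedPts α)
    {a b ε : ℝ} (hε : 0 < ε) (ha : 2 * ε < a) (hb : 2 * ε < b) (hab : 3 * ε < |b - a|) {q q' : A}
    (hq : q ∈ bandSet α (Metric.ball a ε)) (hq' : q' ∈ bandSet α (Metric.ball b ε)) (x : A) :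
    star q * x * q' = 0 := by
  have hqs : star q ∈ bandSet α (Metric.ball (-a) ε) := by
    simpa using hα.star_mem_bandSet hq
  have hqn : star q ∈ bandSet α (Iio 0) := bandSet_mono (fun ξ hξ => by
    rw [Metric.mem_ball, Real.dist_eq, abs_lt] at hξ
    rw [mem_Iio]
    linarith [hξ.2]) hqs
  have hqp : q' ∈ bandSet α (Ioi 0) := bandSet_mono (fun ξ hξ => by
    rw [Metric.mem_ball, Real.dist_eq, abs_lt] at hξ
    rw [mem_Ioi]
    linarith [hξ.1]) hq'
  have key : ∀ φ : 𝓢(ℝ, ℂ), HasCompactSupport φ → star q * fsmear α φ x * q' = 0 := by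
    intro φ hφ
    obtain ⟨φm, φ0, φp, hsum, ⟨hmc, hm⟩, ⟨h0c, h0⟩, ⟨hpc, hp⟩⟩ := exists_split hφ hε
    have xm := hα.fsmear_mem_bandSet isOpen_Iio hmc hm x
    have x0 := hα.fsmear_mem_bandSet Metric.isOpen_ball h0c h0 x
    have xp := hα.fsmear_mem_bandSet isOpen_Ioi hpc hp x
    have e1 : star q * fsmear α φm x * q' = 0 := by
      refine eq_zero_of_mem_bandSet_of_fixed (U := Iio 0) self_notMem_Iio ?_ (H _ hqn _ _ hqp)
      rw [mul_assoc]
      exact hα.mul_fixed_mem_bandSet (hα.mul_mem_fixedPts fun y => H _ xm y _ hqp) hqn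
    have e2 : star q * fsmear α φp x * q' = 0 := by
      refine eq_zero_of_mem_bandSet_of_fixed (U := Ioi 0) self_notMem_Ioi ?_ (H _ hqn _ _ hqp)
      exact hα.fixed_mul_mem_bandSet (hα.mul_mem_fixedPts fun y => H _ hqn y _ xp) hqp
    have e3 : star q * fsmear α φ0 x * q' = 0 := by
      refine eq_zero_of_mem_bandSet_of_fixed (U := {0}ᶜ) (by simp) ?_ (H _ hqn _ _ hqp)
      rw [mul_assoc]
      refine hα.mul_mem_bandSet isOpen_compl_singleton ?_ hqs
        (hα.mul_mem_bandSet Metric.isOpen_ball (W := Metric.ball b (ε + ε)) ?_ x0 hq')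
      · rw [ball_add_ball hε (by positivity)]
        intro ξ hξ h
        rw [mem_singleton_iff] at h
        rw [h, Metric.mem_ball, Real.dist_eq, zero_sub, abs_neg, neg_add_eq_sub] at hξ
        linarith
      · rw [ball_add_ball hε hε, zero_add]
    rw [hsum, hα.fsmear_add, hα.fsmear_add, mul_add, mul_add, add_mul, add_mul, e1, e2, e3,
      add_zero, add_zero]
  obtain ⟨θ, hθ, hlim⟩ := hα.exists_tendsto_fsmear
  refine tendsto_nhds_unique (((hlim x).const_mul (star q)).mul_const q') ?_
  simp [key _ (hθ _)]

lemma _root_.PeligradMax.specO_subset_of_isClosedTwoSidedIdealIn {Y : Set A}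
    (hY : IsClosedTwoSidedIdealIn univ Y) (hYinv : Invariant α Y) (U : Set ℝ) :
    specO α Y U ⊆ Y := by
  obtain ⟨-, hcl, h0, hadd, hsmul, -⟩ := hY
  let M : Submodule ℂ A :=
    { carrier := Y
      add_mem' := fun {x y} hx hy => hadd x hx y hy
      zero_mem' := h0
      smul_mem' := hsmul }
  have : CompleteSpace M := hcl.isComplete.completeSpace_coe
  refine closure_minimal (Submodule.span_le (p := M).2 ?_) hcl
  rintro y ⟨x, hx, f, -, -, -, rfl⟩
  have h := M.subtypeₗᵢ.integral_comp_comm (μ := volume)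
    fun t => (⟨f t • α t x, hsmul _ _ (hYinv t x hx)⟩ : M)
  have h2 : smear α f x = ((∫ t, (⟨f t • α t x, hsmul _ _ (hYinv t x hx)⟩ : M) : M) : A) := h
  rw [h2]
  exact Subtype.property (p := (· ∈ Y)) _

lemma _root_.PeligradMax.fourierT_fourierInv (φ : 𝓢(ℝ, ℂ)) :
    fourierT (⇑(𝓕⁻ φ : 𝓢(ℝ, ℂ))) =
      φ ∘ Homeomorph.mulLeft₀ (2 * Real.pi)⁻¹ (by positivity) := by
  ext γ
  have h : (𝓕 (𝓕⁻ φ : 𝓢(ℝ, ℂ)) : 𝓢(ℝ, ℂ)) ((2 * Real.pi)⁻¹ * γ) = φ ((2 * Real.pi)⁻¹ * γ) := by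
    rw [FourierTransform.fourier_fourierInv_eq]
  rw [SchwartzMap.fourier_coe, Real.fourier_real_eq_integral_exp_smul] at h
  rw [Function.comp_apply, Homeomorph.coe_mulLeft₀, ← h, fourierT]
  congr 1 with t
  rw [smul_eq_mul, mul_comm]
  congr 2
  have : (Real.pi : ℂ) ≠ 0 := by exact_mod_cast Real.pi_ne_zero
  push_cast
  field_simp

lemma _root_.PeligradMax.bandSet_subset_specO {U V : Set ℝ}
    (hUV : ∀ ξ ∈ U, 2 * Real.pi * ξ ∈ V) : bandSet α U ⊆ specO α univ V := by
  rintro x ⟨φ, hφ, hφU, hx⟩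
  refine subset_closure (Submodule.subset_span ⟨x, mem_univ _, ⇑(𝓕⁻ φ : 𝓢(ℝ, ℂ)),
    (𝓕⁻ φ : 𝓢(ℝ, ℂ)).integrable, ?_, ?_, hx.symm⟩)
  · rw [fourierT_fourierInv]
    exact hφ.comp_homeomorph _
  · rw [fourierT_fourierInv, tsupport_comp_eq_preimage]
    intro γ hγ
    have h := hUV _ (hφU hγ)
    rwa [Homeomorph.coe_mulLeft₀, mul_inv_cancel_left₀ (by positivity)] at h

lemma eq_zero_of_star_time_mul (hα : IsCStarDynSys α) {Y : Set A}
    (hY : IsClosedTwoSidedIdealIn univ Y) (hYinv : Invariant α Y) (hYs : AlphaSimple α Y)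
    {q q' : A} (hq : q ∈ Y) (hq' : q' ∈ Y) (hne : q' ≠ 0)
    (h : ∀ s x, star (α s q) * x * q' = 0) : q = 0 := by
  obtain ⟨-, hcl, h0, hadd, hsmul, hmul⟩ := hY
  have hK : IsClosedTwoSidedIdealIn Y {y ∈ Y | ∀ s x, star (α s q) * x * y = 0} := by
    refine ⟨fun y hy => hy.1, ?_, ⟨h0, by simp⟩, fun y hy z hz => ⟨hadd y hy.1 z hz.1,
      fun s x => ?_⟩, fun c y hy => ⟨hsmul c y hy.1, fun s x => ?_⟩, fun z hz y hy =>
      ⟨⟨(hmul z (mem_univ z) y hy.1).1, fun s x => ?_⟩, (hmul z (mem_univ z) y hy.1).2,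
        fun s x => ?_⟩⟩
    · have : {y ∈ Y | ∀ s x, star (α s q) * x * y = 0} =
          Y ∩ ⋂ s, ⋂ x, {y | star (α s q) * x * y = 0} := by
        ext y
        simp
      rw [this]
      exact hcl.inter (isClosed_iInter fun s => isClosed_iInter fun x =>
        isClosed_eq (continuous_const_mul _) continuous_const)
    · rw [mul_add, hy.2, hz.2, add_zero]
    · rw [mul_smul_comm, hy.2, smul_zero]
    · rw [← mul_assoc, mul_assoc _ x z, hy.2]
    · rw [← mul_assoc, hy.2, zero_mul]
  have hKinv : Invariant α {y ∈ Y | ∀ s x, star (α s q) * x * y = 0} := by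
    refine fun t y hy => ⟨hYinv t y hy.1, fun s x => ?_⟩
    have h1 : star (α s q) * x * α t y =
        α t (star (α (-t + s) q) * α (-t) x * y) := by
      rw [hα.map_mul, hα.map_mul, hα.map_star, ← hα.map_add_time, ← hα.map_add_time,
        add_neg_cancel_left, add_neg_cancel, hα.map_zero_time]
    rw [h1, hy.2, hα.map_zero]
  rcases hYs _ hK hKinv with h1 | h1
  · exact absurd (h1.subset ⟨hq', h⟩) hne
  · have h2 := (h1.symm.subset hq).2 0 (q * star q)
    rw [hα.map_zero_time] at h2
    have h3 : star (star q * q) * (star q * q) = 0 := by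
      rw [star_mul, star_star, ← h2]
      simp only [mul_assoc]
    exact CStarRing.star_mul_self_eq_zero_iff q |>.1 (CStarRing.star_mul_self_eq_zero_iff _ |>.1 h3)

lemma eq_zero_of_mul_star_time (hα : IsCStarDynSys α) {Y : Set A}
    (hY : IsClosedTwoSidedIdealIn univ Y) (hYinv : Invariant α Y) (hYs : AlphaSimple α Y)
    {q q' : A} (hq : q ∈ Y) (hq' : q' ∈ Y) (hne : q' ≠ 0)
    (h : ∀ s x, q' * x * star (α s q) = 0) : q = 0 := by
  obtain ⟨-, hcl, h0, hadd, hsmul, hmul⟩ := hY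
  have hK : IsClosedTwoSidedIdealIn Y {y ∈ Y | ∀ s x, y * x * star (α s q) = 0} := by
    refine ⟨fun y hy => hy.1, ?_, ⟨h0, by simp⟩, fun y hy z hz => ⟨hadd y hy.1 z hz.1,
      fun s x => ?_⟩, fun c y hy => ⟨hsmul c y hy.1, fun s x => ?_⟩, fun z hz y hy =>
      ⟨⟨(hmul z (mem_univ z) y hy.1).1, fun s x => ?_⟩, (hmul z (mem_univ z) y hy.1).2,
        fun s x => ?_⟩⟩
    · have : {y ∈ Y | ∀ s x, y * x * star (α s q) = 0} =
          Y ∩ ⋂ s, ⋂ x, {y | y * x * star (α s q) = 0} := by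
        ext y
        simp
      rw [this]
      exact hcl.inter (isClosed_iInter fun s => isClosed_iInter fun x =>
        isClosed_eq (by fun_prop) continuous_const)
    · rw [add_mul, add_mul, hy.2, hz.2, add_zero]
    · rw [smul_mul_assoc, smul_mul_assoc, hy.2, smul_zero]
    · rw [mul_assoc, mul_assoc, ← mul_assoc y, hy.2, mul_zero]
    · rw [mul_assoc y, hy.2]
  have hKinv : Invariant α {y ∈ Y | ∀ s x, y * x * star (α s q) = 0} := by
    refine fun t y hy => ⟨hYinv t y hy.1, fun s x => ?_⟩
    have h1 : α t y * x * star (α s q) =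
        α t (y * α (-t) x * star (α (-t + s) q)) := by
      rw [hα.map_mul, hα.map_mul, hα.map_star, ← hα.map_add_time, ← hα.map_add_time,
        add_neg_cancel_left, add_neg_cancel, hα.map_zero_time]
    rw [h1, hy.2, hα.map_zero]
  rcases hYs _ hK hKinv with h1 | h1
  · exact absurd (h1.subset ⟨hq', h⟩) hne
  · have h2 := (h1.symm.subset hq).2 0 (star q * q)
    rw [hα.map_zero_time] at h2
    have h3 : star (q * star q) * (q * star q) = 0 := by
      rw [star_mul, star_star, ← h2]
      simp only [mul_assoc]
    exact CStarRing.mul_star_self_eq_zero_iff q |>.1 (CStarRing.star_mul_self_eq_zero_iff _ |>.1 h3)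

lemma zero_mem_specC (hα : IsCStarDynSys α) (F : Set ℝ) : (0 : A) ∈ specC α F := by
  intro γ hγ
  obtain ⟨χ, -, -, hone⟩ := exists_cutoff (isCompact_singleton (x := (2 * Real.pi)⁻¹ * γ))
    isOpen_univ (subset_univ _)
  have h := hγ (⇑(𝓕⁻ χ : 𝓢(ℝ, ℂ))) (𝓕⁻ χ : 𝓢(ℝ, ℂ)).integrable (by simp [smear, hα.map_zero])
  rw [fourierT_fourierInv, Function.comp_apply, Homeomorph.coe_mulLeft₀, hone _ rfl] at h
  exact absurd h one_ne_zero

lemma exists_mem_bandSet_of_actSpec (hα : IsCStarDynSys α) {γ : ℝ}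
    (hγ : γ ∈ actSpec α (univ : Set A)) {ε : ℝ} (hε : 0 < ε) :
    ∃ q ≠ 0, q ∈ bandSet α (Metric.ball (|γ| / (2 * Real.pi)) ε) := by
  have h := hγ ε hε
  obtain ⟨q, hq, hne⟩ : ∃ q ∈ specC α (Icc (γ - ε) (γ + ε)), q ≠ 0 := by
    by_contra! hn
    refine h (Subset.antisymm (fun q hq => hn q hq.2) ?_)
    rintro _ rfl
    exact ⟨mem_univ _, hα.zero_mem_specC _⟩
  have hb : q ∈ bandSet α (Metric.ball (γ / (2 * Real.pi)) ε) := by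
    refine hα.mem_bandSet_of_specC Metric.isOpen_ball (fun ξ hξ => ?_) hq
    have hpi : 1 < 2 * Real.pi := by linarith [Real.pi_gt_three]
    have h1 : ε / (2 * Real.pi) < ε := div_lt_self hε hpi
    obtain ⟨h2, h3⟩ := hξ
    rw [sub_div] at h2
    rw [add_div] at h3
    rw [Metric.mem_ball, Real.dist_eq, abs_lt]
    constructor <;> linarith
  rcases abs_choice γ with h | h <;> rw [h]
  · exact ⟨q, hne, hb⟩
  · refine ⟨star q, star_ne_zero.2 hne, ?_⟩
    simpa [neg_div] using hα.star_mem_bandSet hb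

lemma not_fixed_of_ideal (hα : IsCStarDynSys α) {γ γ' : ℝ}
    (hγ : γ ∈ actSpec α (univ : Set A)) (hγ' : γ' ∈ actSpec α (univ : Set A)) (h0 : γ ≠ 0)
    (h0' : γ' ≠ 0) (hne : |γ| ≠ |γ'|) {Y : Set A} (hY : IsClosedTwoSidedIdealIn univ Y)
    (hYinv : Invariant α Y) (hYs : AlphaSimple α Y)
    (hYpos : specO α Y (Ioi 0) = specO α univ (Ioi 0)) :
    (¬ ∀ n ∈ bandSet α (Iio 0), ∀ x, ∀ p ∈ bandSet α (Ioi 0), n * x * p ∈ fixedPts α) ∧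
    ¬ ∀ n ∈ bandSet α (Ioi 0), ∀ x, ∀ p ∈ bandSet α (Iio 0), n * x * p ∈ fixedPts α := by
  set a := |γ| / (2 * Real.pi) with ha
  set b := |γ'| / (2 * Real.pi) with hb
  have ha0 : 0 < a := div_pos (abs_pos.2 h0) (by positivity)
  have hb0 : 0 < b := div_pos (abs_pos.2 h0') (by positivity)
  have hab : 0 < |b - a| := by
    refine abs_pos.2 (sub_ne_zero.2 fun h => hne ?_)
    rw [ha, hb, div_left_inj' (by positivity)] at h
    exact h.symm
  obtain ⟨ε, hε, h1, h2, h3⟩ : ∃ ε > 0, 2 * ε < a ∧ 2 * ε < b ∧ 3 * ε < |b - a| := by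
    refine ⟨min (min a b) |b - a| / 4, by positivity, ?_, ?_, ?_⟩
    · linarith [min_le_left (min a b) |b - a|, min_le_left a b]
    · linarith [min_le_left (min a b) |b - a|, min_le_right a b]
    · linarith [min_le_right (min a b) |b - a|]
  obtain ⟨q, hq0, hq⟩ := hα.exists_mem_bandSet_of_actSpec hγ hε
  obtain ⟨q', hq0', hq'⟩ := hα.exists_mem_bandSet_of_actSpec hγ' hε
  rw [← ha] at hq
  rw [← hb] at hq'
  have hmem : ∀ {c : ℝ} {z : A}, 2 * ε < c → z ∈ bandSet α (Metric.ball c ε) → z ∈ Y := by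
    intro c z hc hz
    refine specO_subset_of_isClosedTwoSidedIdealIn hY hYinv (Ioi 0) (hYpos.symm.subset ?_)
    refine bandSet_subset_specO (fun ξ hξ => ?_) hz
    rw [Metric.mem_ball, Real.dist_eq, abs_lt] at hξ
    exact mul_pos Real.two_pi_pos (by linarith [hξ.1] : (0 : ℝ) < ξ)
  constructor
  · intro H
    exact hq0 (hα.eq_zero_of_star_time_mul hY hYinv hYs (hmem h1 hq) (hmem h2 hq') hq0'
      fun s x => hα.star_mul_mul_eq_zero_of_bandSet H hε h1 h2 h3 (hα.time_mem_bandSet hq s) hq' x)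
  · intro H
    have hrev : ∀ {c : ℝ} {z : A}, z ∈ bandSet α (Metric.ball c ε) →
        star z ∈ bandSet (fun t => α (-t)) (Metric.ball c ε) := fun hz =>
      mem_bandSet_reverse (hα.star_mem_bandSet hz)
    refine hq0 (hα.eq_zero_of_mul_star_time hY hYinv hYs (hmem h1 hq) (hmem h2 hq') hq0'
      fun s x => ?_)
    rw [abs_sub_comm] at h3
    have h4 := hα.reverse.star_mul_mul_eq_zero_of_bandSet (fun n hn x p hp t => H n ?_ x p ?_ (-t))
      hε h2 h1 h3 (hrev hq') (hrev (hα.time_mem_bandSet hq s)) x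
    · rwa [star_star] at h4
    · simpa using mem_bandSet_of_reverse hn
    · simpa using mem_bandSet_of_reverse hp

end IsCStarDynSys

lemma exists_ne_zero_abs_ne {S : Set ℝ} {a b c d : ℝ} (ha : a ∈ S) (hb : b ∈ S) (hc : c ∈ S)
    (hd : d ∈ S) (hab : a ≠ b) (hac : a ≠ c) (had : a ≠ d) (hbc : b ≠ c) (hbd : b ≠ d)
    (hcd : c ≠ d) : ∃ x ∈ S, ∃ y ∈ S, x ≠ 0 ∧ y ≠ 0 ∧ |x| ≠ |y| := by
  have three : ∀ x ∈ S, ∀ y ∈ S, ∀ z ∈ S, x ≠ 0 → y ≠ 0 → z ≠ 0 → x ≠ y → x ≠ z → y ≠ z →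
      ∃ x ∈ S, ∃ y ∈ S, x ≠ 0 ∧ y ≠ 0 ∧ |x| ≠ |y| := by
    intro x hx y hy z hz x0 y0 z0 hxy hxz hyz
    by_cases h : |x| = |y|
    · refine ⟨x, hx, z, hz, x0, z0, fun h' => hyz ?_⟩
      rw [← neg_inj, ← (abs_eq_abs.1 h).resolve_left hxy, (abs_eq_abs.1 h').resolve_left hxz]
    · exact ⟨x, hx, y, hy, x0, y0, h⟩
  by_cases a0 : a = 0
  · subst a0
    exact three b hb c hc d hd hab.symm hac.symm had.symm hbc hbd hcd
  by_cases b0 : b = 0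
  · subst b0
    exact three a ha c hc d hd a0 hbc.symm hbd.symm hac had hcd
  by_cases c0 : c = 0
  · subst c0
    exact three a ha b hb d hd a0 b0 hcd.symm hab had hbd
  exact three a ha b hb c hc a0 b0 c0 hab hac hbc

end Smearing

/-- **Lemma 4.13.** If `sp(α)` contains more than three points and `X^α([0,∞))` is maximal,
then, with `Y` the `α`-simple ideal of Lemma 4.10, neither the closed span `Z₁` of
`X^α((−∞,0)) X X^α((0,∞))` nor the closed span `Z₂` of `X^α((0,∞)) X X^α((−∞,0))`
is contained in `Y^α = Y ∩ X^α`. -/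
theorem spans_not_subset_fixedPts (α : ℝ → X → X) (hα : IsCStarDynSys α)
    (hfour : ∃ a b c d : ℝ, a ∈ actSpec α (univ : Set X) ∧ b ∈ actSpec α (univ : Set X) ∧
      c ∈ actSpec α (univ : Set X) ∧ d ∈ actSpec α (univ : Set X) ∧
      a ≠ b ∧ a ≠ c ∧ a ≠ d ∧ b ≠ c ∧ b ≠ d ∧ c ≠ d)
    (hmax : IsMaximalClosedSubalgebra (specC α (Ici (0 : ℝ))))
    (Y : Set X) (hY : IsClosedTwoSidedIdealIn (univ : Set X) Y)
    (hYinv : Invariant α Y) (hYsimple : AlphaSimple α Y)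
    (hYpos : specO α Y (Ioi (0 : ℝ)) = specO α (univ : Set X) (Ioi (0 : ℝ)))
    (hYdense : closure (Y + specC α (Ici (0 : ℝ))) = (univ : Set X)) :
    ¬ ClosedSpan (MulSet3 (specO α (univ : Set X) (Iio (0 : ℝ))) (univ : Set X)
        (specO α (univ : Set X) (Ioi (0 : ℝ)))) ⊆ Y ∩ fixedPts α ∧
    ¬ ClosedSpan (MulSet3 (specO α (univ : Set X) (Ioi (0 : ℝ))) (univ : Set X)
        (specO α (univ : Set X) (Iio (0 : ℝ)))) ⊆ Y ∩ fixedPts α := by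
  let _ : NonUnitalCStarAlgebra X := {}
  obtain ⟨a, b, c, d, ha, hb, hc, hd, hab, hac, had, hbc, hbd, hcd⟩ := hfour
  obtain ⟨γ, hγ, γ', hγ', h0, h0', hne⟩ :=
    exists_ne_zero_abs_ne ha hb hc hd hab hac had hbc hbd hcd
  have hpos : bandSet α (Ioi 0) ⊆ specO α univ (Ioi 0) :=
    bandSet_subset_specO fun ξ hξ => mul_pos Real.two_pi_pos hξ
  have hneg : bandSet α (Iio 0) ⊆ specO α univ (Iio 0) :=
    bandSet_subset_specO fun ξ hξ => mul_neg_of_pos_of_neg Real.two_pi_pos hξ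
  obtain ⟨h1, h2⟩ := hα.not_fixed_of_ideal hγ hγ' h0 h0' hne hY hYinv hYsimple hYpos
  exact ⟨fun h => h1 fun n hn x p hp => (h (subset_closure (Submodule.subset_span
      ⟨n, hneg hn, x, mem_univ x, p, hpos hp, rfl⟩))).2,
    fun h => h2 fun n hn x p hp => (h (subset_closure (Submodule.subset_span
      ⟨n, hpos hn, x, mem_univ x, p, hneg hp, rfl⟩))).2⟩

end PeligradMax
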